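/- arXiv:1909.00108 — 2 statements merged into one kernel-verified Lean document; each statement's English description precedes it below -/
import Mathlib

section
/- If [q₀,…,q_r] ∈ A₂ and either r = 0 or |q_r| ≥ 3, then g([q₀,…,q_r]) = C(E([q₀,…,q_r])); that is, g applied to the list yields the short continued fraction representation of its continued fraction value. -/
/-- Continued fraction value of a list of integers (junk value `0` on `[]`,
division by zero yields junk, as usual in Lean). -/
def E : List ℤ → ℚ
  | [] => 0
  | [q] => (q : ℚ)
  | q :: l => (q : ℚ) + 1 / E l

/-- The continued fraction value of the list is well defined: the list is
nonempty and no division by zero occurs in the evaluation of `E`. -/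
def EWellDef : List ℤ → Prop
  | [] => False
  | [_] => True
  | _ :: l => EWellDef l ∧ E l ≠ 0

/-- Membership in `A₀`: `[q₀,…,q_r]` with `q_i ≠ 0` for `1 ≤ i ≤ r` and
`E([q_i,…,q_r]) ≠ 0` for `0 < i < r`. -/
def memA0 (l : List ℤ) : Prop :=
  l ≠ [] ∧ (∀ i, 0 < i → i < l.length → l.getD i 0 ≠ 0) ∧
    ∀ i, 0 < i → i + 1 < l.length → E (l.drop i) ≠ 0

/-- Membership in `A₁`: member of `A₀` with `q_i ≥ 1` for `0 < i < r` and
`q_r > 1` when `r > 0`. -/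
def memA1 (l : List ℤ) : Prop :=
  memA0 l ∧ (∀ i, 0 < i → i + 1 < l.length → 1 ≤ l.getD i 0) ∧
    (1 < l.length → 1 < l.getD (l.length - 1) 0)

/-- Membership in `A₂`: member of `A₀` with `|q_i| > 1` for `0 < i ≤ r`. -/
def memA2 (l : List ℤ) : Prop :=
  memA0 l ∧ ∀ i, 0 < i → i < l.length → 1 < |l.getD i 0|

/-- Euclidean-algorithm computation of the short continued fraction of `a/b`. -/
def scfAux (a : ℤ) (b : ℕ) : List ℤ :=
  if hb : b = 0 then []
  else
    have h0 : 0 ≤ Int.emod a (b : ℤ) := Int.emod_nonneg a (by exact_mod_cast hb)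
    have h1 : Int.emod a (b : ℤ) < (b : ℤ) :=
      Int.emod_lt_of_pos a (by exact_mod_cast Nat.pos_of_ne_zero hb)
    if hr : (Int.emod a (b : ℤ)).toNat = 0 then [Int.ediv a (b : ℤ)]
    else Int.ediv a (b : ℤ) :: scfAux (b : ℤ) (Int.emod a (b : ℤ)).toNat
  termination_by b
  decreasing_by omega

/-- `C x` is the short continued fraction representation of the rational `x`,
i.e. the unique list in `A₁` whose continued fraction value is `x`. -/
def C (x : ℚ) : List ℤ := scfAux x.num x.den

/-- Entrywise negation of a list. -/
def negL (l : List ℤ) : List ℤ := l.map (fun q => -q)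

/-- The operation `⊕` on lists. -/
def oplus (a b : List ℤ) : List ℤ :=
  match b with
  | [] => a
  | p :: ps =>
    if p = 0 then a.dropLast ++ (a.getLastD 0 + ps.headD 0) :: ps.tail
    else a ++ (p :: ps)

/-- The function `f : A₁ → A₂`. -/
def f (l : List ℤ) : List ℤ :=
  if h : (l.tail.dropLast).findIdx (fun q => q == 1) < l.tail.dropLast.length then
    let j := (l.tail.dropLast).findIdx (fun q => q == 1) + 1
    oplus (l.take (j - 1) ++ [l.getD (j - 1) 0 + 1])
      (negL (f ((l.getD (j + 1) 0 + 1) :: l.drop (j + 2))))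
  else l
  termination_by l.length
  decreasing_by
    simp only [List.length_dropLast, List.length_tail, List.length_cons,
      List.length_drop] at h ⊢
    omega

/-- The function `g : A₂ → A₁`. -/
def g (l : List ℤ) : List ℤ :=
  if h : (l.tail).findIdx (fun q => decide (q < 0)) < l.tail.length then
    let j := (l.tail).findIdx (fun q => decide (q < 0)) + 1
    oplus (l.take (j - 1) ++ [l.getD (j - 1) 0 - 1, 1])
      (g (negL ((l.getD j 0 + 1) :: l.drop (j + 1))))
  else l
  termination_by l.length
  decreasing_by
    simp only [negL, List.length_map, List.length_cons, List.length_drop,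
      List.length_tail] at h ⊢
    omega

/-- `[q₀,…,q_r]` satisfies the `(u,v)`-divisibility property: `v ∣ q_i` for even
`i` and `u ∣ q_i` for odd `i`. -/
def DivProp (u v : ℤ) (l : List ℤ) : Prop :=
  ∀ i, i < l.length → (i % 2 = 0 → v ∣ l.getD i 0) ∧ (i % 2 = 1 → u ∣ l.getD i 0)

lemma E_cons_cons (q p : ℤ) (t : List ℤ) : E (q :: p :: t) = q + 1 / E (p :: t) := rfl

lemma negL_cons (q : ℤ) (t : List ℤ) : negL (q :: t) = -q :: negL t := rfl

lemma E_negL (l : List ℤ) : E (negL l) = -E l := by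
  induction l with
  | nil => simp [negL, E]
  | cons q t ih =>
    cases t with
    | nil => simp [negL, E]
    | cons p t =>
      rw [negL_cons] at ih
      rw [negL_cons, negL_cons, E_cons_cons, E_cons_cons, ih]
      push_cast
      rw [div_neg]
      ring

lemma E_add_head (n q : ℤ) (t : List ℤ) : E ((q + n) :: t) = E (q :: t) + n := by
  cases t with
  | nil => simp [E]
  | cons p t =>
    rw [E_cons_cons, E_cons_cons]
    push_cast
    ring

/-! ### The short continued fraction of a rational -/

lemma C_intCast (n : ℤ) : C n = [n] := by
  rw [C, scfAux]
  have h1 : Int.emod n 1 = 0 := Int.emod_one n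
  have h2 : Int.ediv n 1 = n := Int.ediv_one n
  simp [h1, h2]

lemma C_intCast_add_one_div (q : ℤ) {y : ℚ} (hy : 1 < y) : C (q + 1 / y) = q :: C y := by
  have hd : (0 : ℤ) < y.den := by exact_mod_cast y.den_pos
  have hlt : (y.den : ℤ) < y.num := by
    have h := (Rat.lt_iff 1 y).1 hy
    simpa using h
  obtain ⟨n, hn⟩ : ∃ n : ℕ, y.num = n := ⟨y.num.toNat, by omega⟩
  have hn0 : (0 : ℤ) < n := by omega
  have hcop : Nat.Coprime (q * n + y.den).natAbs (n : ℤ).natAbs := by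
    have h : IsCoprime (n : ℤ) (y.den : ℤ) := by
      rw [Int.isCoprime_iff_gcd_eq_one]
      have := y.reduced
      rw [hn] at this
      simpa [Int.gcd] using this
    have h2 : IsCoprime (q * n + y.den : ℤ) (n : ℤ) := by
      have := (h.symm.add_mul_left_left q)
      rwa [add_comm, mul_comm] at this
    exact Int.isCoprime_iff_gcd_eq_one.1 h2
  have hx : (q : ℚ) + 1 / y = ((q * n + y.den : ℤ) : ℚ) / ((n : ℤ) : ℚ) := by
    have hy' : y = (n : ℚ) / y.den := by
      conv_lhs => rw [← Rat.num_div_den y, hn]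
      simp
    have hn1 : (n : ℚ) ≠ 0 := by exact_mod_cast hn0.ne'
    have hd1 : (y.den : ℚ) ≠ 0 := by exact_mod_cast hd.ne'
    have h1 : 1 / y = (y.den : ℚ) / n := by
      conv_lhs => rw [hy', one_div_div]
    rw [h1]
    push_cast
    field_simp
  have hnum := Rat.num_div_eq_of_coprime hn0 hcop
  have hden := Rat.den_div_eq_of_coprime hn0 hcop
  rw [← hx] at hnum hden
  have hden' : ((q : ℚ) + 1 / y).den = n := by exact_mod_cast hden
  have hmod : Int.emod (q * n + y.den) n = y.den := by
    change (q * n + y.den) % (n : ℤ) = y.den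
    rw [Int.mul_add_emod_self_right, Int.emod_eq_of_lt hd.le (by omega)]
  have hdiv : Int.ediv (q * n + y.den) n = q := by
    change (q * n + y.den) / (n : ℤ) = q
    rw [Int.add_comm, Int.add_mul_ediv_right _ _ hn0.ne',
      Int.ediv_eq_zero_of_lt hd.le (by omega), zero_add]
  rw [C, hnum, hden', scfAux, dif_neg (by omega), C, hn]
  simp only [hmod, hdiv]
  simp

lemma C_of_zero_lt_of_lt_one {z : ℚ} (h0 : 0 < z) (h1 : z < 1) : C z = 0 :: C (1 / z) := by
  have h := C_intCast_add_one_div 0 (y := 1 / z) (by rwa [lt_div_iff₀ h0, one_mul])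
  simpa using h

lemma C_eq_floor_cons (x : ℚ) : ∃ t : List ℤ, ∀ n : ℤ, C (x + n) = (⌊x⌋ + n) :: t := by
  rcases eq_or_ne (Int.fract x) 0 with h | h
  · refine ⟨[], fun n => ?_⟩
    have hx : x + n = ((⌊x⌋ + n : ℤ) : ℚ) := by
      have := Int.floor_add_fract x
      push_cast
      linarith
    rw [hx, C_intCast]
  · refine ⟨C (1 / Int.fract x), fun n => ?_⟩
    have hpos : 0 < Int.fract x := lt_of_le_of_ne (Int.fract_nonneg x) h.symm
    have hlt : 1 < 1 / Int.fract x := by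
      rw [lt_div_iff₀ hpos, one_mul]
      exact Int.fract_lt_one x
    rw [← C_intCast_add_one_div _ hlt]
    congr 1
    have := Int.floor_add_fract x
    push_cast
    rw [one_div_one_div]
    linarith

/-- Joining `[q, 1]` to the short continued fraction of `z`. -/
lemma oplus_C (q : ℤ) {z : ℚ} (h0 : 0 < z) (h1 : z ≠ 1) :
    oplus [q, 1] (C z) = q :: C (1 + 1 / z) := by
  rcases lt_or_gt_of_ne h1 with h | h
  · obtain ⟨t, ht⟩ := C_eq_floor_cons (1 / z)
    have e0 := ht 0
    have e1 := ht 1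
    simp only [Int.cast_zero, add_zero, Int.cast_one] at e0 e1
    rw [C_of_zero_lt_of_lt_one h0 h, e0, add_comm 1 (1 / z), e1]
    simp [oplus, add_comm]
  · obtain ⟨t, ht⟩ := C_eq_floor_cons z
    have e0 := ht 0
    simp only [Int.cast_zero, add_zero] at e0
    have hf : ⌊z⌋ ≠ 0 := by
      have : (1 : ℤ) ≤ ⌊z⌋ := Int.le_floor.2 (by exact_mod_cast h.le)
      omega
    have hc := C_intCast_add_one_div 1 h
    rw [Int.cast_one] at hc
    rw [hc, e0]
    simp [oplus, hf]

/-! ### Recursion for `g` along the list -/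

lemma oplus_cons (q : ℤ) {a : List ℤ} (ha : a ≠ []) (b : List ℤ) :
    oplus (q :: a) b = q :: oplus a b := by
  obtain ⟨x, a, rfl⟩ := List.exists_cons_of_ne_nil ha
  cases b with
  | nil => rfl
  | cons p ps =>
    by_cases hp : p = 0 <;> simp [oplus, hp]

lemma g_singleton (q : ℤ) : g [q] = [q] := by
  rw [g]
  simp

lemma g_cons_cons_of_neg (q : ℤ) {p : ℤ} (hp : p < 0) (t : List ℤ) :
    g (q :: p :: t) = oplus [q - 1, 1] (g (negL ((p + 1) :: t))) := by
  rw [g]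
  simp [List.findIdx_cons, hp]

lemma g_cons_cons_of_pos (q : ℤ) {p : ℤ} (hp : 0 < p) (t : List ℤ) :
    g (q :: p :: t) = q :: g (p :: t) := by
  have hp' : ¬ p < 0 := by omega
  have hidx : (p :: t).findIdx (fun q => decide (q < 0)) =
      t.findIdx (fun q => decide (q < 0)) + 1 := by
    simp [List.findIdx_cons, hp']
  rw [g.eq_def (q :: p :: t), g.eq_def (p :: t)]
  by_cases h : t.findIdx (fun q => decide (q < 0)) < t.length
  · rw [dif_pos (by simpa [hidx] using h), dif_pos (by simpa using h), ← oplus_cons _ (by simp)]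
    simp [hidx]
  · rw [dif_neg (by simpa [hidx] using h), dif_neg (by simpa using h)]

/-! ### Lists with entries of absolute value at least two -/

/-- All entries have absolute value at least `2`, the last one at least `3`. -/
def LargeEntries (t : List ℤ) : Prop :=
  (∀ x ∈ t, 2 ≤ |x|) ∧ ∀ x ∈ t.getLast?, 3 ≤ |x|

lemma LargeEntries.negL {t : List ℤ} (h : LargeEntries t) : LargeEntries (negL t) := by
  constructor
  · intro x hx
    obtain ⟨y, hy, rfl⟩ := List.mem_map.1 hx
    rw [abs_neg]
    exact h.1 y hy
  · intro x hx
    rw [_root_.negL, List.getLast?_map, Option.mem_map] at hx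
    obtain ⟨y, hy, rfl⟩ := hx
    rw [abs_neg]
    exact h.2 y hy

lemma LargeEntries.tail {p : ℤ} {t : List ℤ} (h : LargeEntries (p :: t)) : LargeEntries t := by
  refine ⟨fun x hx => h.1 x (List.mem_cons_of_mem _ hx), fun x hx => h.2 x ?_⟩
  cases t with
  | nil => simp at hx
  | cons a t => simpa [List.getLast?_cons_cons] using hx

lemma LargeEntries.E_bounds {p : ℤ} {t : List ℤ} (h : LargeEntries (p :: t)) :
    (0 < p → 1 < E (p :: t) ∧ E (p :: t) ≠ 2) ∧
      (p < 0 → E (p :: t) < -1 ∧ E (p :: t) ≠ -2) := by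
  induction t generalizing p with
  | nil =>
    have h3 := h.2 p (by simp)
    simp only [E]
    refine ⟨fun hp => ?_, fun hp => ?_⟩
    · rw [abs_of_pos hp] at h3
      exact ⟨by exact_mod_cast (by omega : 1 < p), by exact_mod_cast (by omega : p ≠ 2)⟩
    · rw [abs_of_neg hp] at h3
      exact ⟨by exact_mod_cast (by omega : p < -1), by exact_mod_cast (by omega : p ≠ -2)⟩
  | cons a t ih =>
    have h2 := h.1 p (by simp)
    have ha : a ≠ 0 := fun h0 => by simpa [h0] using h.1 a (by simp)
    have hy : 1 < |E (a :: t)| := by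
      rcases lt_or_gt_of_ne ha with hneg | hpos
      · exact lt_abs.2 (Or.inr (by linarith [((ih h.tail).2 hneg).1]))
      · exact lt_abs.2 (Or.inl ((ih h.tail).1 hpos).1)
    rw [E_cons_cons]
    set u := 1 / E (a :: t) with hu
    have hu0 : u ≠ 0 := by
      rw [hu]
      exact one_div_ne_zero (abs_pos.1 (by linarith))
    have hu1 : |u| < 1 := by
      rw [hu, abs_div, abs_one, div_lt_one (by linarith)]
      exact hy
    obtain ⟨hul, hur⟩ := abs_lt.1 hu1
    have hne : ∀ n : ℤ, (p : ℚ) + u ≠ n := by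
      intro n hn
      have hun : u = ((n - p : ℤ) : ℚ) := by
        push_cast
        linarith
      rw [hun] at hul hur hu0
      have h1 : -1 < n - p := by exact_mod_cast hul
      have h2 : n - p < 1 := by exact_mod_cast hur
      exact hu0 (by exact_mod_cast (by omega : n - p = 0))
    refine ⟨fun hp => ⟨?_, by exact_mod_cast hne 2⟩, fun hp => ⟨?_, by exact_mod_cast hne (-2)⟩⟩
    · rw [abs_of_pos hp] at h2
      have : (2 : ℚ) ≤ p := by exact_mod_cast h2
      linarith
    · rw [abs_of_neg hp] at h2
      have : (p : ℚ) ≤ -2 := by exact_mod_cast (by omega : p ≤ -2)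
      linarith

lemma g_cons_eq_C_of_E (q : ℤ) (t : List ℤ) (h : LargeEntries t) :
    g (q :: t) = C (E (q :: t)) := by
  induction hn : t.length generalizing q t with
  | zero =>
    rw [List.length_eq_zero_iff.1 hn, g_singleton]
    exact (C_intCast q).symm
  | succ n ih =>
    obtain ⟨p, t, rfl⟩ := List.exists_cons_of_length_eq_add_one hn
    have hlen : t.length = n := by simpa using hn
    have hp : p ≠ 0 := fun h0 => by simpa [h0] using h.1 p (by simp)
    rw [E_cons_cons]
    rcases lt_or_gt_of_ne hp with hneg | hpos
    · obtain ⟨hy, hy2⟩ := h.E_bounds.2 hneg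
      set y := E (p :: t)
      have hz : E (negL ((p + 1) :: t)) = -y - 1 := by
        rw [E_negL, E_add_head, Int.cast_one]
        ring
      have hz0 : 0 < -y - 1 := by linarith
      have hz1 : -y - 1 ≠ 1 := fun h1 => hy2 (by linarith)
      have hg : g (negL ((p + 1) :: t)) = C (-y - 1) := by
        rw [← hz]
        exact ih _ _ h.tail.negL (by simpa [negL] using hlen)
      have hw : 1 < 1 + 1 / (-y - 1) := by
        have : 0 < 1 / (-y - 1) := by positivity
        linarith
      rw [g_cons_cons_of_neg q hneg, hg, oplus_C _ hz0 hz1, ← C_intCast_add_one_div _ hw]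
      congr 1
      have hy0 : y ≠ 0 := by linarith
      have hw' : 1 + 1 / (-y - 1) = -y / (-y - 1) := by
        field_simp
        ring
      rw [hw', one_div_div]
      push_cast
      field_simp
      ring
    · rw [g_cons_cons_of_pos q hpos, ih p t h.tail hlen,
        C_intCast_add_one_div q (h.E_bounds.1 hpos).1]

/-- if `[q₀,…,q_r] ∈ A₂` and either `r = 0` or `|q_r| ≥ 3`, then
`g([q₀,…,q_r]) = C(E([q₀,…,q_r]))`, the short continued fraction representation
of its continued fraction value. -/
theorem g_eq_C_of_E (l : List ℤ) (hl : memA2 l)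
    (hlast : l.length = 1 ∨ 3 ≤ |l.getD (l.length - 1) 0|) :
    g l = C (E l) := by
  obtain ⟨q, t, rfl⟩ := List.exists_cons_of_ne_nil hl.1.1
  refine g_cons_eq_C_of_E q t ⟨fun x hx => ?_, fun x hx => ?_⟩
  · obtain ⟨i, hi, rfl⟩ := List.getElem_of_mem hx
    have h := hl.2 (i + 1) (by omega) (by simpa using hi)
    rw [List.getD_cons_succ, List.getD_eq_getElem _ _ hi] at h
    omega
  · obtain ⟨s, rfl⟩ := List.getLast?_eq_some_iff.1 hx
    simpa using hlast
end

section
/- Let u, v ≥ 3 be integers and let M = [[a,b],[c,d]] ∈ 𝒢_{u,v} (so that d ≠ 0). Then M belongs to the group G_{u,v} generated by L_u and R_v if and only if f(C(b/d)) satisfies the (u,v)-divisibility property. -/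
open Matrix

abbrev SL2Z : Type := Matrix.SpecialLinearGroup (Fin 2) ℤ

/-- The matrix `L_u = [[1,0],[u,1]]` as an element of `SL₂(ℤ)`. -/
def Lmat (u : ℤ) : SL2Z := ⟨!![1, 0; u, 1], by simp [Matrix.det_fin_two_of]⟩

/-- The matrix `R_v = [[1,v],[0,1]]` as an element of `SL₂(ℤ)`. -/
def Rmat (v : ℤ) : SL2Z := ⟨!![1, v; 0, 1], by simp [Matrix.det_fin_two_of]⟩

/-- `S_{u,v}`: the submonoid of `SL₂(ℤ)` generated by `L_u` and `R_v`. -/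
def Smonoid (u v : ℤ) : Submonoid SL2Z := Submonoid.closure {Lmat u, Rmat v}

/-- `G_{u,v}`: the subgroup of `SL₂(ℤ)` generated by `L_u` and `R_v`. -/
def Ggroup (u v : ℤ) : Subgroup SL2Z := Subgroup.closure {Lmat u, Rmat v}

/-- `𝒮_{u,v}`. -/
def scrS (u v : ℤ) : Set SL2Z :=
  {M | 0 ≤ M.1 0 0 ∧ 0 ≤ M.1 0 1 ∧ 0 ≤ M.1 1 0 ∧ 0 ≤ M.1 1 1 ∧
    M.1 0 0 ≡ 1 [ZMOD (u * v)] ∧ M.1 1 1 ≡ 1 [ZMOD (u * v)] ∧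
    v ∣ M.1 0 1 ∧ u ∣ M.1 1 0}

/-- `𝒢_{u,v}`. -/
def scrG (u v : ℤ) : Set SL2Z :=
  {M | M.1 0 0 ≡ 1 [ZMOD (u * v)] ∧ M.1 1 1 ≡ 1 [ZMOD (u * v)] ∧
    v ∣ M.1 0 1 ∧ u ∣ M.1 1 0}

/-- The vector `(x, y)` with `x / y` the continued fraction value of the list, computed without
division. -/
def cfVec : List ℤ → ℤ × ℤ
  | [] => (1, 0)
  | q :: l => (q * (cfVec l).1 + (cfVec l).2, (cfVec l).1)

/-- Lists of odd length with the `(u,v)`-divisibility property and no zero entry after the first. -/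
inductive ReducedList (u v : ℤ) : List ℤ → Prop
  | single (q : ℤ) (hq : v ∣ q) : ReducedList u v [q]
  | step (q p r : ℤ) (l : List ℤ) (hq : v ∣ q) (hp : u ∣ p) (hp0 : p ≠ 0) (hr0 : r ≠ 0)
      (h : ReducedList u v (r :: l)) : ReducedList u v (q :: p :: r :: l)

/-! ### The divisibility property -/

theorem divProp_nil (u v : ℤ) : DivProp u v [] := by
  intro i hi
  simp at hi

theorem divProp_cons {u v q : ℤ} {l : List ℤ} :
    DivProp u v (q :: l) ↔ v ∣ q ∧ DivProp v u l := by
  constructor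
  · intro h
    refine ⟨by simpa using (h 0 (by simp)).1, fun i hi => ?_⟩
    have := h (i + 1) (by simpa using hi)
    simp only [List.getD_cons_succ] at this
    exact ⟨fun h2 => this.2 (by omega), fun h2 => this.1 (by omega)⟩
  · rintro ⟨hq, h⟩ i hi
    cases i with
    | zero => simpa using hq
    | succ i =>
      have := h i (by simpa using hi)
      simp only [List.getD_cons_succ]
      exact ⟨fun h2 => this.2 (by omega), fun h2 => this.1 (by omega)⟩

theorem ReducedList.divProp {u v : ℤ} {l : List ℤ} (h : ReducedList u v l) : DivProp u v l := by
  induction h with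
  | single q hq => exact divProp_cons.2 ⟨hq, divProp_nil _ _⟩
  | step q p r l hq hp _ _ _ ih => exact divProp_cons.2 ⟨hq, divProp_cons.2 ⟨hp, ih⟩⟩

theorem three_le_abs_of_dvd {u p : ℤ} (hu : 3 ≤ u) (hp : u ∣ p) (hp0 : p ≠ 0) : 3 ≤ |p| :=
  hu.trans (Int.le_of_dvd (abs_pos.2 hp0) ((dvd_abs _ _).2 hp))

theorem ReducedList.exists_cons {u v : ℤ} (hu : 3 ≤ u) (hv : 3 ≤ v) {l : List ℤ}
    (h : ReducedList u v l) : ∃ q t, l = q :: t ∧ v ∣ q ∧ ∀ p ∈ t, 3 ≤ |p| := by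
  induction h with
  | single q hq => exact ⟨q, [], rfl, hq, by simp⟩
  | step q p r l hq hp hp0 hr0 _ ih =>
    obtain ⟨q', t, hqt, hq', ht⟩ := ih
    obtain ⟨rfl, rfl⟩ := List.cons.inj hqt
    refine ⟨q, _, rfl, hq, ?_⟩
    simp only [List.mem_cons, forall_eq_or_imp]
    exact ⟨three_le_abs_of_dvd hu hp hp0, three_le_abs_of_dvd hv hq' hr0, ht⟩

/-! ### Values of lists -/

theorem cfVec_negL (l : List ℤ) : ∃ e : ℤ, (e = 1 ∨ e = -1) ∧
    (cfVec (negL l)).1 = e * (cfVec l).1 ∧ (cfVec (negL l)).2 = -(e * (cfVec l).2) := by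
  induction l with
  | nil => exact ⟨1, Or.inl rfl, by simp [negL, cfVec]⟩
  | cons q l ih =>
    obtain ⟨e, he, h1, h2⟩ := ih
    simp only [negL] at h1 h2
    refine ⟨-e, by omega, ?_, ?_⟩
    · simp only [negL, List.map_cons, cfVec, h1, h2]; ring
    · simp only [negL, List.map_cons, cfVec, h1]; ring

theorem negL_negL (l : List ℤ) : negL (negL l) = l := by
  simp [negL]

theorem two_mul_abs_cfVec_snd_lt {l : List ℤ} (h : ∀ p ∈ l, 3 ≤ |p|) :
    2 * |(cfVec l).2| < |(cfVec l).1| := by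
  induction l with
  | nil => simp [cfVec]
  | cons q l ih =>
    simp only [List.mem_cons, forall_eq_or_imp] at h
    have ih := ih h.2
    have h1 := abs_sub_abs_le_abs_sub (q * (cfVec l).1) (-(cfVec l).2)
    rw [abs_mul, abs_neg, sub_neg_eq_add] at h1
    have h2 := abs_nonneg (cfVec l).2
    simp only [cfVec]
    nlinarith [h.1]

/-! ### The Euclidean algorithm -/

theorem scfAux_one (a : ℤ) : scfAux a 1 = [a] := by
  rw [scfAux]
  simp [show Int.emod a 1 = 0 from Int.emod_one a,
    show Int.ediv a 1 = a from Int.ediv_one a]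

theorem scfAux_mul_add (q : ℤ) {n m : ℕ} (hm : 0 < m) (hmn : m < n) :
    scfAux (q * n + m) n = q :: scfAux n m := by
  have hn : (n : ℤ) ≠ 0 := by omega
  have h1 : Int.emod (q * n + m) n = m := by
    change (q * n + m) % (n : ℤ) = m
    rw [add_comm, Int.add_mul_emod_self_right]
    exact Int.emod_eq_of_lt (by omega) (by omega)
  have h2 : Int.ediv (q * n + m) n = q := by
    change (q * n + m) / (n : ℤ) = q
    rw [add_comm, Int.add_mul_ediv_right _ _ hn, Int.ediv_eq_zero_of_lt (by omega) (by omega)]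
    simp
  rw [scfAux, dif_neg (by omega : n ≠ 0)]
  simp only [h1, h2, Int.toNat_natCast]
  rw [dif_neg (by omega)]

theorem scfAux_eq_cons (a : ℤ) {m : ℕ} (hm : 0 < m) :
    ∃ t, ∀ k : ℤ, scfAux (a + k * m) m = (a / m + k) :: t := by
  have hm' : (m : ℤ) ≠ 0 := by omega
  have h1 (k : ℤ) : Int.emod (a + k * m) m = a % m := Int.add_mul_emod_self_right _ _ _
  have h2 (k : ℤ) : Int.ediv (a + k * m) m = a / m + k := Int.add_mul_ediv_right _ _ hm'
  by_cases hr : (a % (m : ℤ)).toNat = 0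
  · refine ⟨[], fun k => ?_⟩
    rw [scfAux, dif_neg (by omega)]
    simp only [h1, h2]
    rw [dif_pos hr]
  · refine ⟨scfAux m (a % (m : ℤ)).toNat, fun k => ?_⟩
    rw [scfAux, dif_neg (by omega)]
    simp only [h1, h2]
    rw [dif_neg hr]

theorem scfAux_spec {a : ℤ} {n : ℕ} (hn : 0 < n) (h : IsCoprime a n) :
    ∃ t, scfAux a n = (a / n) :: t ∧ (∀ p ∈ t, 1 ≤ p) ∧ cfVec (scfAux a n) = (a, (n : ℤ)) := by
  induction n using Nat.strong_induction_on generalizing a with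
  | _ n ih =>
    have hn' : (n : ℤ) ≠ 0 := by omega
    have hlt := Int.emod_lt_of_pos a (by omega : (0 : ℤ) < n)
    have hnn := Int.emod_nonneg a hn'
    have hdiv := Int.emod_add_mul_ediv a n
    by_cases hr : a % (n : ℤ) = 0
    · have : (n : ℤ) ∣ 1 := by
        obtain ⟨x, y, hxy⟩ := h
        rw [← hxy]
        exact dvd_add ((Int.dvd_of_emod_eq_zero hr).mul_left _) (dvd_mul_left _ _)
      have h1 : n = 1 := by exact_mod_cast Int.eq_one_of_dvd_one (by omega) this
      subst h1
      rw [scfAux_one]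
      exact ⟨[], by simp, by simp, by simp [cfVec]⟩
    · obtain ⟨m, hm⟩ := Int.eq_ofNat_of_zero_le hnn
      have ha : a = (a / n) * n + m := by rw [← hm]; linarith
      have hm0 : 0 < m := by omega
      have hmn : m < n := by omega
      have hcop : IsCoprime (n : ℤ) m := by
        rw [ha] at h
        exact ((IsCoprime.mul_add_right_left_iff).1 h).symm
      obtain ⟨t, ht, hpos, hval⟩ := ih m hmn hm0 hcop
      have hs : scfAux a n = (a / n) :: scfAux n m := by
        conv_lhs => rw [ha]
        exact scfAux_mul_add _ hm0 hmn
      refine ⟨_, hs, ?_, ?_⟩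
      · rw [ht]
        simp only [List.mem_cons, forall_eq_or_imp]
        exact ⟨(Int.le_ediv_iff_mul_le (by omega)).2 (by omega), hpos⟩
      · rw [hs, cfVec, hval]
        exact Prod.ext ha.symm rfl

theorem scfAux_mul_sub (q : ℤ) {n m : ℕ} (hm : 0 < m) (hmn : 2 * m < n) :
    ∃ p t, scfAux (q * n - m) n = (q - 1) :: 1 :: p :: t ∧ scfAux n m = (p + 1) :: t := by
  have h1 : scfAux (q * n - m) n = (q - 1) :: scfAux n (n - m) := by
    rw [← scfAux_mul_add (q - 1) (by omega : 0 < n - m) (by omega)]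
    congr 1
    push_cast [show m ≤ n by omega]
    ring
  have h2 : scfAux n (n - m) = 1 :: scfAux ((n - m : ℕ) : ℤ) m := by
    rw [← scfAux_mul_add 1 hm (by omega)]
    congr 1
    push_cast [show m ≤ n by omega]
    ring
  obtain ⟨t, ht⟩ := scfAux_eq_cons ((n - m : ℕ) : ℤ) hm
  refine ⟨((n - m : ℕ) : ℤ) / m, t, ?_, ?_⟩
  · rw [h1, h2, show scfAux ((n - m : ℕ) : ℤ) m = _ by simpa using ht 0]
  · rw [← ht 1]
    congr 1
    push_cast [show m ≤ n by omega]
    ring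

theorem C_div_eq_scfAux {a : ℤ} {n : ℕ} (hn : 0 < n) (h : IsCoprime a n) :
    C ((a : ℚ) / n) = scfAux a n := by
  have hc : Nat.Coprime a.natAbs (n : ℤ).natAbs := Int.isCoprime_iff_gcd_eq_one.1 h
  have h1 := Rat.num_div_eq_of_coprime (by omega : (0 : ℤ) < n) hc
  have h2 := Rat.den_div_eq_of_coprime (by omega : (0 : ℤ) < n) hc
  rw [C]
  simp only [Int.cast_natCast] at h1 h2
  rw [h1, show ((a : ℚ) / n).den = n by exact_mod_cast h2]

/-! ### The map `f` -/

theorem f_singleton (q : ℤ) : f [q] = [q] := by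
  rw [f]; simp

theorem f_cons_one_cons (q p : ℤ) (t : List ℤ) :
    f (q :: 1 :: p :: t) = oplus [q + 1] (negL (f ((p + 1) :: t))) := by
  rw [f]
  simp [List.findIdx_cons]

theorem f_cons_cons_of_ne_one (q : ℤ) {p : ℤ} (hp : p ≠ 1) (t : List ℤ) :
    f (q :: p :: t) = q :: f (p :: t) := by
  cases t with
  | nil => rw [f, f_singleton]; simp
  | cons r t =>
    have hp' : (p == 1) = false := by simpa using hp
    have hidx : (q :: p :: r :: t).tail.dropLast.findIdx (fun q => q == 1) =
        (p :: r :: t).tail.dropLast.findIdx (fun q => q == 1) + 1 := by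
      simp [List.findIdx_cons, hp']
    have hlen : (q :: p :: r :: t).tail.dropLast.length =
        (p :: r :: t).tail.dropLast.length + 1 := by simp
    rw [f.eq_def (q :: p :: r :: t), f.eq_def (p :: r :: t)]
    by_cases h : (p :: r :: t).tail.dropLast.findIdx (fun q => q == 1) <
        (p :: r :: t).tail.dropLast.length
    · rw [dif_pos h, dif_pos (by rw [hidx, hlen]; omega), hidx]
      simp only [Nat.add_sub_cancel, List.take_succ_cons, List.getD_cons_succ, List.cons_append,
        List.drop_succ_cons]
      generalize negL _ = b
      cases b with
      | nil => rfl
      | cons x xs =>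
        simp only [oplus]
        split_ifs
        · generalize hw : List.take _ (p :: r :: t) ++ [_] = w
          have : w ≠ [] := by rw [← hw]; simp
          cases w with
          | nil => contradiction
          | cons y ys => simp [List.getLastD]
        · simp
    · rw [dif_neg h, dif_neg (by rw [hidx, hlen]; omega)]

theorem oplus_of_ne_zero (a : List ℤ) {p : ℤ} (hp : p ≠ 0) (l : List ℤ) :
    oplus a (p :: l) = a ++ p :: l := by
  simp [oplus, hp]

/-- On a list with positive tail, `f` preserves the value and does not decrease the head. -/
theorem f_spec (h : ℤ) (t : List ℤ) (ht : ∀ p ∈ t, 1 ≤ p) :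
    ∃ h' t', f (h :: t) = h' :: t' ∧ h ≤ h' ∧ ∃ e : ℤ, (e = 1 ∨ e = -1) ∧
      (cfVec (f (h :: t))).1 = e * (cfVec (h :: t)).1 ∧
      (cfVec (f (h :: t))).2 = e * (cfVec (h :: t)).2 := by
  induction hk : t.length using Nat.strong_induction_on generalizing h t with
  | _ k ih =>
    match t, ht, hk with
    | [], _, _ => exact ⟨h, [], f_singleton h, le_rfl, 1, Or.inl rfl, by simp [f_singleton]⟩
    | p :: t, ht, hk =>
      simp only [List.mem_cons, forall_eq_or_imp, List.length_cons] at ht hk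
      by_cases hp : p = 1
      · subst hp
        match t, ht, hk with
        | [], _, _ =>
          have : f [h, 1] = [h, 1] := by rw [f]; simp
          exact ⟨h, [1], this, le_rfl, 1, Or.inl rfl, by simp [this]⟩
        | r :: t, ht, hk =>
          simp only [List.mem_cons, forall_eq_or_imp, List.length_cons] at ht hk
          obtain ⟨x, xs, hx, hrx, e, he, h1, h2⟩ := ih t.length (by omega) (r + 1) t ht.2.2 rfl
          obtain ⟨e', he', h1', h2'⟩ := cfVec_negL (f ((r + 1) :: t))
          have hf : f (h :: 1 :: r :: t) = (h + 1) :: negL (f ((r + 1) :: t)) := by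
            rw [f_cons_one_cons, hx]
            exact oplus_of_ne_zero _ (neg_ne_zero.2 (by omega)) _
          refine ⟨h + 1, _, hf, by omega, e' * e, by grind, ?_, ?_⟩
          · rw [hf, cfVec, h1', h2', h1, h2]
            simp only [cfVec]
            ring
          · rw [hf, cfVec, h1', h1]
            simp only [cfVec]
            ring
      · obtain ⟨x, xs, hx, hrx, e, he, h1, h2⟩ := ih t.length (by omega) p t ht.2 rfl
        have hf := f_cons_cons_of_ne_one h hp t
        refine ⟨h, _, hf, le_rfl, e, he, ?_, ?_⟩
        · rw [hf, cfVec, h1, h2, cfVec.eq_2 h]; ring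
        · rw [hf, cfVec, h1, cfVec.eq_2 h]

/-- A list whose entries after the first are at least `3` in absolute value is recovered by `f`
from the short continued fraction of its value. -/
theorem f_scfAux_of_three_le_abs (q : ℤ) (t : List ℤ) (ht : ∀ p ∈ t, 3 ≤ |p|) :
    ∃ (e a : ℤ) (n : ℕ), (e = 1 ∨ e = -1) ∧ 0 < n ∧ cfVec (q :: t) = (e * a, e * n) ∧
      f (scfAux a n) = q :: t := by
  induction hk : t.length generalizing q t with
  | zero =>
    obtain rfl := List.length_eq_zero_iff.1 hk
    exact ⟨1, q, 1, Or.inl rfl, one_pos, by simp [cfVec], by rw [scfAux_one, f_singleton]⟩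
  | succ k ih =>
    match t, ht, hk with
    | p :: t, ht, hk =>
      simp only [List.length_cons, add_left_inj] at hk
      have hlt := two_mul_abs_cfVec_snd_lt ht
      have hp3 : 3 ≤ |p| := ht p (by simp)
      have ht' : ∀ p ∈ t, 3 ≤ |p| := fun x hx => ht x (by simp [hx])
      have hneg : ∀ p ∈ negL t, 3 ≤ |p| := by
        intro x hx
        obtain ⟨y, hy, rfl⟩ := List.mem_map.1 hx
        rw [abs_neg]
        exact ht' y hy
      obtain ⟨e, a, m, he, hm, hV, hf⟩ := ih p t ht' hk
      obtain ⟨e₁, a₁, m₁, he₁, hm₁, hV₁, hf₁⟩ := ih (-p) (negL t) hneg (by simpa [negL] using hk)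
      obtain ⟨e₂, he₂, hN1, hN2⟩ := cfVec_negL (p :: t)
      have hnc : negL (p :: t) = -p :: negL t := rfl
      rw [hnc, hV₁, hV] at hN1 hN2
      rw [hV] at hlt
      have hlt' : 2 * (m : ℤ) < |a| := by
        rcases he with rfl | rfl <;> simpa using hlt
      simp only at hN1 hN2
      have hmm : (m₁ : ℤ) = m := by
        rcases he with rfl | rfl <;> rcases he₁ with rfl | rfl <;> rcases he₂ with rfl | rfl <;>
          omega
      have haa : a₁ = -a := by
        rcases he with rfl | rfl <;> rcases he₁ with rfl | rfl <;> rcases he₂ with rfl | rfl <;>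
          omega
      obtain rfl : m₁ = m := by exact_mod_cast hmm
      rcases le_total 0 a with ha | ha
      · obtain ⟨n, rfl⟩ := Int.eq_ofNat_of_zero_le ha
        rw [abs_of_nonneg ha] at hlt'
        refine ⟨e, q * n + m₁, n, he, by omega, ?_, ?_⟩
        · rw [cfVec, hV]
          refine Prod.ext ?_ rfl
          simp only
          ring
        · rw [scfAux_mul_add q hm (by omega)]
          obtain ⟨s, hs⟩ := scfAux_eq_cons n hm
          have hs := hs 0
          simp only [zero_mul, add_zero] at hs
          have h2 : 2 ≤ (n : ℤ) / m₁ := (Int.le_ediv_iff_mul_le (by omega)).2 (by omega)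
          rw [hs, f_cons_cons_of_ne_one q (by omega), ← hs, hf]
      · obtain ⟨n, hn⟩ := Int.eq_ofNat_of_zero_le (neg_nonneg.2 ha)
        rw [abs_of_nonpos ha] at hlt'
        obtain rfl : a = -n := by omega
        obtain ⟨r, s, h1, h2⟩ := scfAux_mul_sub q hm (n := n) (by omega)
        refine ⟨-e, q * n - m₁, n, by omega, by omega, ?_, ?_⟩
        · rw [cfVec, hV]
          refine Prod.ext ?_ ?_ <;> simp only <;> ring
        · rw [haa, neg_neg, h2] at hf₁
          rw [h1, f_cons_one_cons, hf₁, ← hnc, negL_negL, sub_add_cancel]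
          refine oplus_of_ne_zero _ ?_ _
          rintro rfl
          simp at hp3

/-! ### The groups -/

theorem mul_apply_eq (A B : SL2Z) (i j : Fin 2) :
    (A * B).1 i j = A.1 i 0 * B.1 0 j + A.1 i 1 * B.1 1 j := by
  change (A.1 * B.1) i j = _
  rw [Matrix.mul_apply, Fin.sum_univ_two]

theorem Rmat_zpow (v k : ℤ) : Rmat v ^ k = Rmat (k * v) := by
  have hadd (x y : ℤ) : Rmat x * Rmat y = Rmat (x + y) := by
    ext i j
    rw [mul_apply_eq]
    fin_cases i <;> fin_cases j <;> simp [Rmat, add_comm]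
  have hzero : Rmat 0 = 1 := by
    ext i j
    fin_cases i <;> fin_cases j <;> simp [Rmat]
  induction k using Int.induction_on with
  | zero => simp [hzero]
  | succ k ih => rw [_root_.zpow_add_one, ih, hadd]; congr 1; ring
  | pred k ih =>
    rw [_root_.zpow_sub_one, ih, mul_inv_eq_iff_eq_mul, hadd]; congr 1; ring

theorem Lmat_zpow (u k : ℤ) : Lmat u ^ k = Lmat (k * u) := by
  have hadd (x y : ℤ) : Lmat x * Lmat y = Lmat (x + y) := by
    ext i j
    rw [mul_apply_eq]
    fin_cases i <;> fin_cases j <;> simp [Lmat]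
  have hzero : Lmat 0 = 1 := by
    ext i j
    fin_cases i <;> fin_cases j <;> simp [Lmat]
  induction k using Int.induction_on with
  | zero => simp [hzero]
  | succ k ih => rw [_root_.zpow_add_one, ih, hadd]; congr 1; ring
  | pred k ih =>
    rw [_root_.zpow_sub_one, ih, mul_inv_eq_iff_eq_mul, hadd]; congr 1; ring

theorem Rmat_inv (v : ℤ) : (Rmat v)⁻¹ = Rmat (-v) := by
  simpa using Rmat_zpow v (-1)

theorem Lmat_inv (u : ℤ) : (Lmat u)⁻¹ = Lmat (-u) := by
  simpa using Lmat_zpow u (-1)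

theorem Rmat_mem_Ggroup {u v q : ℤ} (h : v ∣ q) : Rmat q ∈ Ggroup u v := by
  obtain ⟨k, rfl⟩ := h
  rw [mul_comm, ← Rmat_zpow]
  exact zpow_mem (Subgroup.subset_closure (by simp)) _

theorem Lmat_mem_Ggroup {u v q : ℤ} (h : u ∣ q) : Lmat q ∈ Ggroup u v := by
  obtain ⟨k, rfl⟩ := h
  rw [mul_comm, ← Lmat_zpow]
  exact zpow_mem (Subgroup.subset_closure (by simp)) _

theorem Rmat_mul_apply_zero (q : ℤ) (N : SL2Z) (j : Fin 2) :
    (Rmat q * N).1 0 j = N.1 0 j + q * N.1 1 j := by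
  rw [mul_apply_eq]; simp [Rmat]

theorem Rmat_mul_apply_one (q : ℤ) (N : SL2Z) (j : Fin 2) :
    (Rmat q * N).1 1 j = N.1 1 j := by
  rw [mul_apply_eq]; simp [Rmat]

theorem Lmat_mul_apply_zero (q : ℤ) (N : SL2Z) (j : Fin 2) :
    (Lmat q * N).1 0 j = N.1 0 j := by
  rw [mul_apply_eq]; simp [Lmat]

theorem Lmat_mul_apply_one (q : ℤ) (N : SL2Z) (j : Fin 2) :
    (Lmat q * N).1 1 j = q * N.1 0 j + N.1 1 j := by
  rw [mul_apply_eq]; simp [Lmat]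

theorem det_eq_one (M : SL2Z) : M.1 0 0 * M.1 1 1 - M.1 0 1 * M.1 1 0 = 1 := by
  rw [← Matrix.det_fin_two]; exact M.2

theorem Rmat_mul_mem_scrG {u v q : ℤ} (hq : v ∣ q) {N : SL2Z} (h : N ∈ scrG u v) :
    Rmat q * N ∈ scrG u v := by
  obtain ⟨h1, h2, h3, h4⟩ := h
  refine ⟨?_, ?_, ?_, ?_⟩
  · rw [Rmat_mul_apply_zero]
    have : q * N.1 1 0 ≡ 0 [ZMOD (u * v)] :=
      Int.modEq_zero_iff_dvd.2 (by rw [mul_comm u]; exact mul_dvd_mul hq h4)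
    simpa using h1.add this
  · rwa [Rmat_mul_apply_one]
  · rw [Rmat_mul_apply_zero]
    exact dvd_add h3 (hq.mul_right _)
  · rwa [Rmat_mul_apply_one]

theorem Lmat_mul_mem_scrG {u v q : ℤ} (hq : u ∣ q) {N : SL2Z} (h : N ∈ scrG u v) :
    Lmat q * N ∈ scrG u v := by
  obtain ⟨h1, h2, h3, h4⟩ := h
  refine ⟨?_, ?_, ?_, ?_⟩
  · rwa [Lmat_mul_apply_zero]
  · rw [Lmat_mul_apply_one]
    have : q * N.1 0 1 ≡ 0 [ZMOD (u * v)] :=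
      Int.modEq_zero_iff_dvd.2 (mul_dvd_mul hq h3)
    simpa using this.add h2
  · rwa [Lmat_mul_apply_zero]
  · rw [Lmat_mul_apply_one]
    exact dvd_add (hq.mul_right _) h4

theorem one_mem_scrG (u v : ℤ) : (1 : SL2Z) ∈ scrG u v := by
  refine ⟨?_, ?_, ?_, ?_⟩ <;> simp

/-- A property of `1` that is stable under left multiplication by `R_q` for `v ∣ q` and by `L_q`
for `u ∣ q` holds on `G_{u,v}`. -/
theorem Ggroup_induction {u v : ℤ} {P : SL2Z → Prop} (one : P 1)
    (hR : ∀ q N, v ∣ q → P N → P (Rmat q * N)) (hL : ∀ q N, u ∣ q → P N → P (Lmat q * N))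
    {M : SL2Z} (hM : M ∈ Ggroup u v) : P M := by
  induction hM using Subgroup.closure_induction_left with
  | one => exact one
  | mul_left x hx y _ ih =>
    rcases hx with rfl | rfl
    · exact hL _ _ dvd_rfl ih
    · exact hR _ _ dvd_rfl ih
  | inv_mul_cancel x hx y _ ih =>
    rcases hx with rfl | rfl
    · rw [Lmat_inv]; exact hL _ _ (dvd_neg.2 dvd_rfl) ih
    · rw [Rmat_inv]; exact hR _ _ (dvd_neg.2 dvd_rfl) ih

theorem mem_scrG_of_mem_Ggroup {u v : ℤ} {M : SL2Z} (hM : M ∈ Ggroup u v) : M ∈ scrG u v :=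
  Ggroup_induction (one_mem_scrG u v) (fun _ _ hq h => Rmat_mul_mem_scrG hq h)
    (fun _ _ hq h => Lmat_mul_mem_scrG hq h) hM

theorem exists_reducedList_of_mem_Ggroup {u v : ℤ} {M : SL2Z} (hM : M ∈ Ggroup u v) :
    ∃ l, ReducedList u v l ∧ cfVec l = (M.1 0 1, M.1 1 1) := by
  refine Ggroup_induction (P := fun M => ∃ l, ReducedList u v l ∧ cfVec l = (M.1 0 1, M.1 1 1))
    ⟨[0], .single 0 (dvd_zero v), by simp [cfVec]⟩ ?_ ?_ hM
  · rintro k N hk ⟨l, hl, hV⟩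
    rw [Rmat_mul_apply_zero, Rmat_mul_apply_one]
    cases hl with
    | single q hq =>
      refine ⟨_, .single (q + k) (dvd_add hq hk), ?_⟩
      simp only [cfVec, Prod.mk.injEq] at hV ⊢
      exact ⟨by rw [← hV.1, ← hV.2]; ring, hV.2⟩
    | step q p r l hq hp hp0 hr0 h =>
      refine ⟨_, .step (q + k) p r l (dvd_add hq hk) hp hp0 hr0 h, ?_⟩
      simp only [cfVec, Prod.mk.injEq] at hV ⊢
      exact ⟨by rw [← hV.1, ← hV.2]; ring, hV.2⟩
  · rintro k N hk ⟨l, hl, hV⟩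
    rw [Lmat_mul_apply_zero, Lmat_mul_apply_one]
    by_cases hk0 : k = 0
    · exact ⟨l, hl, by simpa [hk0] using hV⟩
    have hcons (q : ℤ) (t : List ℤ) (hq0 : q ≠ 0) (hl : ReducedList u v (q :: t))
        (hV : cfVec (q :: t) = (N.1 0 1, N.1 1 1)) :
        ∃ l, ReducedList u v l ∧ cfVec l = (N.1 0 1, k * N.1 0 1 + N.1 1 1) :=
      ⟨_, .step 0 k q t (dvd_zero v) hk hk0 hq0 hl, by simp [cfVec.eq_2 _ (_ :: _), hV]⟩
    cases hl with
    | single q hq =>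
      by_cases hq0 : q = 0
      · subst hq0
        refine ⟨_, .single 0 hq, ?_⟩
        simp only [cfVec, Prod.mk.injEq] at hV ⊢
        exact ⟨hV.1, by rw [← hV.1, ← hV.2]; ring⟩
      · exact hcons q [] hq0 (.single q hq) hV
    | step q p r l hq hp hp0 hr0 h =>
      by_cases hq0 : q = 0
      · subst hq0
        by_cases hpk : p + k = 0
        · obtain rfl : k = -p := by omega
          refine ⟨_, h, ?_⟩
          simp only [cfVec, Prod.mk.injEq] at hV ⊢
          exact ⟨by rw [← hV.1]; ring, by rw [← hV.1, ← hV.2]; ring⟩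
        · refine ⟨_, .step 0 (p + k) r l hq (dvd_add hp hk) hpk hr0 h, ?_⟩
          simp only [cfVec, Prod.mk.injEq] at hV ⊢
          exact ⟨by rw [← hV.1]; ring, by rw [← hV.1, ← hV.2]; ring⟩
      · exact hcons q _ hq0 (.step q p r l hq hp hp0 hr0 h) hV

theorem exists_mem_Ggroup_of_divProp (u v : ℤ) (l : List ℤ) :
    (DivProp u v l → ∃ N ∈ Ggroup u v, ∃ j, N.1 0 j = (cfVec l).1 ∧ N.1 1 j = (cfVec l).2) ∧
    (DivProp v u l → ∃ N ∈ Ggroup u v, ∃ j, N.1 0 j = (cfVec l).2 ∧ N.1 1 j = (cfVec l).1) := by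
  induction l with
  | nil => exact ⟨fun _ => ⟨1, one_mem _, 0, by simp [cfVec]⟩,
      fun _ => ⟨1, one_mem _, 1, by simp [cfVec]⟩⟩
  | cons q l ih =>
    constructor
    · intro h
      obtain ⟨hq, h⟩ := divProp_cons.1 h
      obtain ⟨N, hN, j, h0, h1⟩ := ih.2 h
      refine ⟨Rmat q * N, mul_mem (Rmat_mem_Ggroup hq) hN, j, ?_, ?_⟩
      · rw [Rmat_mul_apply_zero, h0, h1, cfVec]; ring
      · rw [Rmat_mul_apply_one, h1, cfVec]
    · intro h
      obtain ⟨hq, h⟩ := divProp_cons.1 h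
      obtain ⟨N, hN, j, h0, h1⟩ := ih.1 h
      refine ⟨Lmat q * N, mul_mem (Lmat_mem_Ggroup hq) hN, j, ?_, ?_⟩
      · rw [Lmat_mul_apply_zero, h0, cfVec]
      · rw [Lmat_mul_apply_one, h0, h1, cfVec]

/-- Elements of `𝒢_{u,v}` with equal second column differ by an element of `G_{u,v}`. -/
theorem mem_Ggroup_of_snd_col_eq {u v : ℤ} {M N : SL2Z} (hM : M ∈ scrG u v)
    (hN : N ∈ Ggroup u v) (h0 : N.1 0 1 = M.1 0 1) (h1 : N.1 1 1 = M.1 1 1) :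
    M ∈ Ggroup u v := by
  have hNG := mem_scrG_of_mem_Ggroup hN
  have hdM := det_eq_one M
  have hdN := det_eq_one N
  rw [h0, h1] at hdN
  set k := M.1 1 0 * N.1 0 0 - M.1 0 0 * N.1 1 0 with hk
  have huk : u ∣ k := by
    exact dvd_sub (hM.2.2.2.mul_right _) (hNG.2.2.2.mul_left _)
  have hMN : M = N * Lmat k := by
    ext i j
    rw [mul_apply_eq]
    fin_cases i <;> fin_cases j <;> simp [Lmat, h0, h1, hk]
    · linear_combination (-M.1 0 0) * hdN + N.1 0 0 * hdM
    · linear_combination (-M.1 1 0) * hdN + N.1 1 0 * hdM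
  rw [hMN]
  exact mul_mem hN (Lmat_mem_Ggroup huk)

theorem isCoprime_snd_col (M : SL2Z) : IsCoprime (M.1 0 1) (M.1 1 1) :=
  ⟨-M.1 1 0, M.1 0 0, by linear_combination det_eq_one M⟩

/-- Scaling a coprime pair by a sign does not change the short continued fraction. -/
theorem C_div_eq_scfAux_of_sign {b d e a : ℤ} {n : ℕ} (hbd : IsCoprime b d)
    (he : e = 1 ∨ e = -1) (hn : 0 < n) (hb : b = e * a) (hd : d = e * n) :
    IsCoprime a n ∧ C ((b : ℚ) / d) = scfAux a n := by
  have hcop : IsCoprime a n := by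
    rcases he with rfl | rfl
    · simpa [hb, hd] using hbd
    · simpa [hb, hd, IsCoprime.neg_left_iff, IsCoprime.neg_right_iff] using hbd
  refine ⟨hcop, ?_⟩
  rw [← C_div_eq_scfAux hn hcop, hb, hd]
  rcases he with rfl | rfl <;> simp

/-- Theorem sanovlikeGp: for integers `u, v ≥ 3` and
`M = [[a,b],[c,d]] ∈ 𝒢_{u,v}`, `M` belongs to the group `G_{u,v}` generated by
`L_u` and `R_v` if and only if `f(C(b/d))` satisfies the `(u,v)`-divisibility
property. -/
theorem sanovlikeGp (u v : ℤ) (hu : 3 ≤ u) (hv : 3 ≤ v) (M : SL2Z)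
    (hM : M ∈ scrG u v) :
    M ∈ Ggroup u v ↔ DivProp u v (f (C ((M.1 0 1 : ℚ) / (M.1 1 1 : ℚ)))) := by
  have hcop := isCoprime_snd_col M
  constructor
  · intro h
    obtain ⟨l, hl, hV⟩ := exists_reducedList_of_mem_Ggroup h
    obtain ⟨q, t, rfl, -, ht⟩ := hl.exists_cons hu hv
    obtain ⟨e, a, n, he, hn, hV', hf⟩ := f_scfAux_of_three_le_abs q t ht
    rw [hV, Prod.mk.injEq] at hV'
    rw [(C_div_eq_scfAux_of_sign hcop he hn hV'.1 hV'.2).2, hf]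
    exact hl.divProp
  · intro h
    have hd1 : u * v ∣ 1 - M.1 1 1 := hM.2.1.dvd
    have hnot_dvd {x : ℤ} (hx0 : x ≠ 0) (hx : |x| < 3) : ¬ u ∣ x :=
      fun hux => absurd (three_le_abs_of_dvd hu hux hx0) (not_le.2 hx)
    have hud : u ∣ 1 - M.1 1 1 := (dvd_mul_right u v).trans hd1
    have hd0 : M.1 1 1 ≠ 0 := by
      intro h0
      rw [h0] at hud
      exact hnot_dvd (x := 1 - 0) (by norm_num) (by norm_num) hud
    obtain ⟨e, n, he, hn, hd⟩ : ∃ (e : ℤ) (n : ℕ), (e = 1 ∨ e = -1) ∧ 0 < n ∧ M.1 1 1 = e * n := by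
      refine ⟨(M.1 1 1).sign, (M.1 1 1).natAbs, ?_, Int.natAbs_pos.2 hd0,
        (Int.sign_mul_natAbs _).symm⟩
      rcases lt_or_gt_of_ne hd0 with h | h
      · exact Or.inr (Int.sign_eq_neg_one_of_neg h)
      · exact Or.inl (Int.sign_eq_one_of_pos h)
    have hb : M.1 0 1 = e * (e * M.1 0 1) := by rcases he with rfl | rfl <;> ring
    obtain ⟨hcop', hC⟩ := C_div_eq_scfAux_of_sign hcop he hn hb hd
    obtain ⟨t, ht, hpos, hval⟩ := scfAux_spec hn hcop'
    obtain ⟨-, -, -, -, e', he', h1, h2⟩ := f_spec _ t hpos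
    rw [← ht, hval] at h1 h2
    rw [hC] at h
    obtain ⟨N, hN, j, hj0, hj1⟩ := (exists_mem_Ggroup_of_divProp u v _).1 h
    have hNG := mem_scrG_of_mem_Ggroup hN
    obtain ⟨s, hs, hs0, hs1⟩ : ∃ s : ℤ, (s = 1 ∨ s = -1) ∧
        N.1 0 j = s * M.1 0 1 ∧ N.1 1 j = s * M.1 1 1 := by
      refine ⟨e' * e, by grind, by rw [hj0, h1]; ring, ?_⟩
      rw [hj1, h2, hd]
      rcases he with rfl | rfl <;> ring
    fin_cases j
    · have huN : u ∣ s * M.1 1 1 := hs1 ▸ hNG.2.2.2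
      have : u ∣ s := by
        have := dvd_add huN (hud.mul_left s)
        rwa [show s * M.1 1 1 + s * (1 - M.1 1 1) = s by ring] at this
      rcases hs with rfl | rfl
      · exact absurd this (hnot_dvd (by norm_num) (by norm_num))
      · exact absurd this (hnot_dvd (by norm_num) (by norm_num))
    · rcases hs with rfl | rfl
      · exact mem_Ggroup_of_snd_col_eq hM hN (by simpa using hs0) (by simpa using hs1)
      · have huN : u ∣ 1 - -1 * M.1 1 1 :=
          hs1 ▸ (dvd_mul_right u v).trans hNG.2.1.dvd
        have := dvd_add huN hud
        rw [show 1 - -1 * M.1 1 1 + (1 - M.1 1 1) = 2 by ring] at this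
        exact absurd this (hnot_dvd (by norm_num) (by norm_num))
end
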